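/- For any real q > 1, the identity (1/2)[(-Q^{1/2}; Q)_∞ + (Q^{1/2}; Q)_∞] = F(Q^3, Q^8)/(Q^2;Q^2)_∞ holds, where Q = 1/q, (A;Q)_∞ = ∏_{k≥0}(1 - A Q^k), and F(X,R) = (R;R)_∞ (-X;R)_∞ (-R/X;R)_∞. -/

import Mathlib

/-- `F(X,R) = (R;R)_∞ (-X;R)_∞ (-R/X;R)_∞` over the reals. -/
noncomputable def jacobiF (X R : ℝ) : ℝ :=
  (∏' k : ℕ, (1 - R * R ^ k)) * (∏' k : ℕ, (1 + X * R ^ k)) * (∏' k : ℕ, (1 + (R / X) * R ^ k))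

open Filter Topology

/-- The reciprocal `1 / (r;r)_n`, extended by zero to negative `n`. -/
noncomputable def invQFactorial (r : ℝ) (n : ℤ) : ℝ :=
  if 0 ≤ n then (∏ i ∈ Finset.range n.toNat, (1 - r * r ^ i))⁻¹ else 0

lemma one_sub_mul_pow_pos {r : ℝ} (h0 : 0 < r) (h1 : r < 1) (i : ℕ) : 0 < 1 - r * r ^ i := by
  have := pow_lt_one₀ h0.le h1 (Nat.succ_ne_zero i)
  rw [pow_succ'] at this
  linarith

lemma invQFactorial_sub_one {r : ℝ} (h0 : 0 < r) (h1 : r < 1) (n : ℤ) :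
    invQFactorial r (n - 1) = (1 - r ^ n) * invQFactorial r n := by
  rcases lt_trichotomy n 0 with hn | rfl | hn
  · simp [invQFactorial, show ¬ 0 ≤ n by omega, show ¬ 1 ≤ n by omega]
  · simp [invQFactorial]
  · obtain ⟨m, rfl⟩ : ∃ m : ℕ, n = m + 1 := ⟨(n - 1).toNat, by omega⟩
    have hm : ((m : ℤ) + 1).toNat = m + 1 := by omega
    have hne := (one_sub_mul_pow_pos h0 h1 m).ne'
    have hz : r ^ ((m : ℤ) + 1) = r * r ^ m := by
      rw [zpow_add₀ h0.ne', zpow_natCast, zpow_one, mul_comm]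
    simp only [invQFactorial, add_sub_cancel_right, Int.natCast_nonneg, if_true, Int.toNat_natCast,
      hm, show (0 : ℤ) ≤ m + 1 by omega, Finset.prod_range_succ, hz, mul_inv]
    rw [mul_comm (_⁻¹) (_⁻¹), mul_inv_cancel_left₀ hne]

/-- The finite form of the Jacobi triple product identity. -/
lemma hasSum_finite_jacobi_triple {s X : ℝ} (h0 : 0 < s) (h1 : s < 1) (hX : X ≠ 0) (n m : ℕ) :
    HasSum (fun k : ℤ ↦ (∏ i ∈ Finset.range (n + m), (1 - s ^ 2 * (s ^ 2) ^ i)) *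
        invQFactorial (s ^ 2) (n - k) * invQFactorial (s ^ 2) (m + k) * (s ^ (k * (k - 1)) * X ^ k))
      ((∏ i ∈ Finset.range n, (1 + X * (s ^ 2) ^ i)) *
        ∏ i ∈ Finset.range m, (1 + s ^ 2 / X * (s ^ 2) ^ i)) := by
  have hr0 : 0 < s ^ 2 := by positivity
  have hr1 : s ^ 2 < 1 := pow_lt_one₀ h0.le h1 two_ne_zero
  have hs := h0.ne'
  induction n with
  | zero =>
    induction m with
    | zero =>
      convert hasSum_ite_eq (0 : ℤ) (1 : ℝ) using 2 with k
      · split_ifs with hk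
        · subst hk; simp [invQFactorial]
        · rcases lt_or_gt_of_ne hk with hk | hk
          · simp [invQFactorial, show ¬ 0 ≤ k by omega]
          · simp [invQFactorial, show ¬ k ≤ 0 by omega]
      · simp
    | succ m ih =>
      have h := ih.add (((Equiv.addRight (1 : ℤ)).hasSum_iff.mpr ih).mul_left
        (s ^ 2 / X * (s ^ 2) ^ m))
      convert h using 1
      · ext k
        simp only [Function.comp_apply, Equiv.coe_addRight, zero_add, Finset.prod_range_succ]
        have e1 := invQFactorial_sub_one hr0 hr1 (-k)
        have e2 := invQFactorial_sub_one hr0 hr1 (m + 1 + k)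
        have a1 : ((0 : ℕ) : ℤ) - k = -k := by simp
        have a2 : ((0 : ℕ) : ℤ) - (k + 1) = -k - 1 := by push_cast; ring
        have a3 : (m : ℤ) + k = m + 1 + k - 1 := by ring
        have a4 : (m : ℤ) + (k + 1) = m + 1 + k := by ring
        have a5 : ((m + 1 : ℕ) : ℤ) + k = m + 1 + k := by push_cast; ring
        rw [a1, a2, a3, a4, a5, e1, e2]
        have b1 : s ^ ((k + 1) * (k + 1 - 1)) = s ^ (k * (k - 1)) * (s ^ 2) ^ k := by
          rw [← zpow_natCast s 2, ← zpow_mul, ← zpow_add₀ hs]; congr 1; push_cast; ring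
        have b2 : (s ^ 2) ^ ((m : ℤ) + 1 + k) = (s ^ 2) ^ m * s ^ 2 * (s ^ 2) ^ k := by
          rw [zpow_add₀ hr0.ne', zpow_add₀ hr0.ne', zpow_natCast, zpow_one]
        rw [b1, b2, zpow_add₀ hX, zpow_one, zpow_neg]
        have hk : (s ^ 2) ^ k ≠ 0 := zpow_ne_zero _ hr0.ne'
        generalize (s ^ 2) ^ k = z at *
        field_simp
        ring
      · rw [Finset.prod_range_succ]; ring
  | succ n ih =>
    have h := ih.add (((Equiv.subRight (1 : ℤ)).hasSum_iff.mpr ih).mul_left (X * (s ^ 2) ^ n))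
    convert h using 1
    · ext k
      simp only [Function.comp_apply, Equiv.subRight_apply]
      have e1 := invQFactorial_sub_one hr0 hr1 (n + 1 - k)
      have e2 := invQFactorial_sub_one hr0 hr1 (m + k)
      have a1 : (n : ℤ) - k = n + 1 - k - 1 := by ring
      have a2 : (n : ℤ) - (k - 1) = n + 1 - k := by ring
      have a3 : (m : ℤ) + (k - 1) = m + k - 1 := by ring
      have a5 : ((n + 1 : ℕ) : ℤ) - k = n + 1 - k := by push_cast; ring
      rw [show n + 1 + m = n + m + 1 by ring, Finset.prod_range_succ, a5, a1, a2, a3, e1, e2]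
      have b1 : s ^ ((k - 1) * (k - 1 - 1)) = s ^ (k * (k - 1)) * s ^ 2 * ((s ^ 2) ^ k)⁻¹ := by
        rw [← zpow_natCast s 2, ← zpow_mul, ← zpow_neg, ← zpow_add₀ hs, ← zpow_add₀ hs]
        congr 1; push_cast; ring
      have b2 : (s ^ 2) ^ ((n : ℤ) + 1 - k) = (s ^ 2) ^ n * s ^ 2 * ((s ^ 2) ^ k)⁻¹ := by
        rw [zpow_sub₀ hr0.ne', zpow_add₀ hr0.ne', zpow_natCast, zpow_one, div_eq_mul_inv]
      have b3 : (s ^ 2) ^ ((m : ℤ) + k) = (s ^ 2) ^ m * (s ^ 2) ^ k := by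
        rw [zpow_add₀ hr0.ne', zpow_natCast]
      rw [b1, b2, b3, zpow_sub₀ hX, zpow_one, pow_add]
      have hk : (s ^ 2) ^ k ≠ 0 := zpow_ne_zero _ hr0.ne'
      generalize (s ^ 2) ^ k = z at *
      field_simp
      ring
    · rw [Finset.prod_range_succ]; ring

lemma summable_pow_mul_pow {s Y : ℝ} (h0 : 0 < s) (h1 : s < 1) (hY : 0 < Y) :
    Summable fun n : ℕ ↦ s ^ (n * n) * Y ^ n := by
  refine summable_of_ratio_test_tendsto_lt_one (l := 0) zero_lt_one
    (Eventually.of_forall fun n ↦ by positivity) ?_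
  have h : Tendsto (fun n : ℕ ↦ (s ^ 2) ^ n * (s * Y)) atTop (𝓝 (0 * (s * Y))) :=
    (tendsto_pow_atTop_nhds_zero_of_lt_one (by positivity)
      (pow_lt_one₀ h0.le h1 two_ne_zero)).mul_const _
  rw [zero_mul] at h
  refine h.congr fun n ↦ ?_
  rw [Real.norm_of_nonneg (by positivity), Real.norm_of_nonneg (by positivity),
    eq_div_iff (by positivity)]
  ring

lemma summable_zpow_mul_zpow {s Y : ℝ} (h0 : 0 < s) (h1 : s < 1) (hY : 0 < Y) :
    Summable fun k : ℤ ↦ s ^ (k * (k - 1)) * Y ^ k := by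
  refine Summable.of_nat_of_neg ?_ ?_
  · refine (summable_pow_mul_pow h0 h1 (div_pos hY h0)).congr fun n ↦ ?_
    rw [mul_sub, mul_one, zpow_sub₀ h0.ne', zpow_natCast, zpow_natCast, ← Nat.cast_mul,
      zpow_natCast, div_pow]
    ring
  · refine (summable_pow_mul_pow h0 h1 (div_pos h0 hY)).congr fun n ↦ ?_
    rw [show -(n : ℤ) * (-n - 1) = ((n * n + n : ℕ) : ℤ) by push_cast; ring, zpow_natCast,
      zpow_neg, zpow_natCast, div_pow, pow_add]
    ring

lemma multipliable_one_add_mul_pow {r : ℝ} (h0 : 0 < r) (h1 : r < 1) (a : ℝ) :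
    Multipliable fun k : ℕ ↦ 1 + a * r ^ k :=
  multipliable_one_add_of_summable
    (((summable_geometric_of_lt_one h0.le h1).mul_left a).norm)

lemma multipliable_one_sub_mul_pow {r : ℝ} (h0 : 0 < r) (h1 : r < 1) (a : ℝ) :
    Multipliable fun k : ℕ ↦ 1 - a * r ^ k := by
  simpa [sub_eq_add_neg] using multipliable_one_add_mul_pow h0 h1 (-a)

lemma prod_one_sub_mul_pow_nonneg {r : ℝ} (h0 : 0 < r) (h1 : r < 1) (n : ℕ) :
    0 ≤ ∏ i ∈ Finset.range n, (1 - r * r ^ i) :=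
  Finset.prod_nonneg fun i _ ↦ (one_sub_mul_pow_pos h0 h1 i).le

lemma tprod_one_sub_mul_pow_pos {r : ℝ} (h0 : 0 < r) (h1 : r < 1) :
    0 < ∏' k : ℕ, (1 - r * r ^ k) := by
  refine lt_of_le_of_ne ?_ (Ne.symm ?_)
  · exact ge_of_tendsto' (multipliable_one_sub_mul_pow h0 h1 r).hasProd.tendsto_prod_nat
      (prod_one_sub_mul_pow_nonneg h0 h1)
  · have := tprod_one_add_ne_zero_of_summable (f := fun k : ℕ ↦ -(r * r ^ k))
      (fun k ↦ by simpa [sub_eq_add_neg] using (one_sub_mul_pow_pos h0 h1 k).ne')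
      (((summable_geometric_of_lt_one h0.le h1).mul_left r).neg.norm)
    simpa [sub_eq_add_neg] using this

lemma tprod_le_prod_one_sub_mul_pow {r : ℝ} (h0 : 0 < r) (h1 : r < 1) (n : ℕ) :
    ∏' k : ℕ, (1 - r * r ^ k) ≤ ∏ i ∈ Finset.range n, (1 - r * r ^ i) := by
  refine Antitone.le_of_tendsto (antitone_nat_of_succ_le fun m ↦ ?_)
    (multipliable_one_sub_mul_pow h0 h1 r).hasProd.tendsto_prod_nat n
  rw [Finset.prod_range_succ]
  refine mul_le_of_le_one_right (prod_one_sub_mul_pow_nonneg h0 h1 m) ?_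
  have : 0 < r * r ^ m := by positivity
  linarith

lemma invQFactorial_nonneg {r : ℝ} (h0 : 0 < r) (h1 : r < 1) (n : ℤ) :
    0 ≤ invQFactorial r n := by
  unfold invQFactorial
  split_ifs
  · exact inv_nonneg.mpr (prod_one_sub_mul_pow_nonneg h0 h1 _)
  · exact le_rfl

lemma invQFactorial_le {r : ℝ} (h0 : 0 < r) (h1 : r < 1) (n : ℤ) :
    invQFactorial r n ≤ (∏' k : ℕ, (1 - r * r ^ k))⁻¹ := by
  have hp := tprod_one_sub_mul_pow_pos h0 h1
  unfold invQFactorial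
  split_ifs
  · exact inv_anti₀ hp (tprod_le_prod_one_sub_mul_pow h0 h1 _)
  · exact (inv_pos.mpr hp).le

lemma tendsto_invQFactorial {r : ℝ} (h0 : 0 < r) (h1 : r < 1) :
    Tendsto (invQFactorial r) atTop (𝓝 (∏' k : ℕ, (1 - r * r ^ k))⁻¹) := by
  have hp := tprod_one_sub_mul_pow_pos h0 h1
  have h := (multipliable_one_sub_mul_pow h0 h1 r).hasProd.tendsto_prod_nat.inv₀ hp.ne'
  have hnat : Tendsto Int.toNat atTop atTop :=
    tendsto_atTop.mpr fun b ↦ (eventually_ge_atTop (b : ℤ)).mono fun n hn ↦ by omega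
  refine (h.comp hnat).congr' ((eventually_ge_atTop 0).mono fun n hn ↦ ?_)
  simp [invQFactorial, hn]

/-- The Jacobi triple product identity. -/
theorem hasSum_jacobiF {s X : ℝ} (h0 : 0 < s) (h1 : s < 1) (hX : X ≠ 0) :
    HasSum (fun k : ℤ ↦ s ^ (k * (k - 1)) * X ^ k) (jacobiF X (s ^ 2)) := by
  have hr0 : 0 < s ^ 2 := by positivity
  have hr1 : s ^ 2 < 1 := pow_lt_one₀ h0.le h1 two_ne_zero
  have hp := tprod_one_sub_mul_pow_pos hr0 hr1
  have hlp := (multipliable_one_sub_mul_pow hr0 hr1 (s ^ 2)).hasProd.tendsto_prod_nat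
  set p := ∏' k : ℕ, (1 - s ^ 2 * (s ^ 2) ^ k) with hpdef
  have hY := abs_pos.mpr hX
  have hsum := summable_zpow_mul_zpow h0 h1 hY
  have hlim := tendsto_tsum_of_dominated_convergence (𝓕 := atTop)
    (f := fun (n : ℕ) (k : ℤ) ↦ (∏ i ∈ Finset.range (n + n), (1 - s ^ 2 * (s ^ 2) ^ i)) *
        invQFactorial (s ^ 2) (n - k) * invQFactorial (s ^ 2) (n + k) * (s ^ (k * (k - 1)) * X ^ k))
    (g := fun k ↦ p * p⁻¹ * p⁻¹ * (s ^ (k * (k - 1)) * X ^ k))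
    (bound := fun k ↦ 1 * p⁻¹ * p⁻¹ * (s ^ (k * (k - 1)) * |X| ^ k))
    (hsum.mul_left _)
    (fun k ↦ by
      refine (((hlp.comp ?_).mul ((tendsto_invQFactorial hr0 hr1).comp ?_)).mul
        ((tendsto_invQFactorial hr0 hr1).comp ?_)).mul_const _
      · exact tendsto_id.atTop_add_atTop tendsto_id
      · exact tendsto_atTop_add_const_right _ (-k) tendsto_natCast_atTop_atTop
      · exact tendsto_atTop_add_const_right _ k tendsto_natCast_atTop_atTop)
    (Eventually.of_forall fun n k ↦ by
      have w1 := invQFactorial_nonneg hr0 hr1 (n - k)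
      have w2 := invQFactorial_nonneg hr0 hr1 (n + k)
      have p1 := prod_one_sub_mul_pow_nonneg hr0 hr1 (n + n)
      rw [norm_mul, norm_mul, norm_mul, norm_mul, norm_zpow X, Real.norm_eq_abs X,
        Real.norm_of_nonneg w1, Real.norm_of_nonneg w2, Real.norm_of_nonneg p1,
        Real.norm_of_nonneg (zpow_nonneg h0.le _)]
      gcongr
      · refine Finset.prod_le_one (fun i _ ↦ (one_sub_mul_pow_pos hr0 hr1 i).le) fun i _ ↦ ?_
        have : 0 < s ^ 2 * (s ^ 2) ^ i := by positivity
        linarith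
      · exact invQFactorial_le hr0 hr1 _
      · exact invQFactorial_le hr0 hr1 _)
  simp_rw [fun n : ℕ ↦ (hasSum_finite_jacobi_triple h0 h1 hX n n).tsum_eq] at hlim
  have hlim' := (multipliable_one_add_mul_pow hr0 hr1 X).hasProd.tendsto_prod_nat.mul
    (multipliable_one_add_mul_pow hr0 hr1 (s ^ 2 / X)).hasProd.tendsto_prod_nat
  have heq := tendsto_nhds_unique hlim' hlim
  rw [tsum_mul_left, mul_inv_cancel₀ hp.ne', one_mul] at heq
  have hsumX : Summable fun k : ℤ ↦ s ^ (k * (k - 1)) * X ^ k := by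
    refine Summable.of_norm (hsum.congr fun k ↦ ?_)
    rw [norm_mul, norm_zpow X, Real.norm_eq_abs X, Real.norm_of_nonneg (zpow_nonneg h0.le _)]
  convert hsumX.hasSum using 1
  rw [jacobiF, ← hpdef, mul_assoc, heq, mul_inv_cancel_left₀ hp.ne']

lemma tprod_mul_tprod_eq_jacobiF {t : ℝ} (h0 : 0 < t ^ 2) (h1 : t ^ 2 < 1) :
    (∏' k : ℕ, (1 - (t ^ 2) ^ 2 * ((t ^ 2) ^ 2) ^ k)) * (∏' k : ℕ, (1 + t * (t ^ 2) ^ k)) =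
      jacobiF t ((t ^ 2) ^ 2) := by
  have ht : t ≠ 0 := by rintro rfl; simp at h0
  have hr0 : 0 < (t ^ 2) ^ 2 := by positivity
  have hr1 : (t ^ 2) ^ 2 < 1 := pow_lt_one₀ h0.le h1 two_ne_zero
  have e1 (k : ℕ) : 1 + t * ((t ^ 2) ^ 2) ^ k = 1 + t * (t ^ 2) ^ (2 * k) := by ring
  have e2 (k : ℕ) : 1 + (t ^ 2) ^ 2 / t * ((t ^ 2) ^ 2) ^ k = 1 + t * (t ^ 2) ^ (2 * k + 1) := by
    field_simp
    ring
  have m1 := multipliable_one_add_mul_pow hr0 hr1 t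
  have m2 := multipliable_one_add_mul_pow hr0 hr1 ((t ^ 2) ^ 2 / t)
  simp_rw [e1] at m1
  simp_rw [e2] at m2
  rw [jacobiF, mul_assoc, tprod_congr e1, tprod_congr e2,
    tprod_even_mul_odd (f := fun k ↦ 1 + t * (t ^ 2) ^ k) m1 m2]

/-- With `Q = 1/q`, `(1/2)[(-Q^{1/2};Q)_∞ + (Q^{1/2};Q)_∞] = F(Q³,Q⁸)/(Q²;Q²)_∞`. -/
theorem mean_products_eq_jacobiF (q : ℝ) (hq : 1 < q) :
    (1 / 2) * ((∏' k : ℕ, (1 + Real.sqrt q⁻¹ * q⁻¹ ^ k))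
        + ∏' k : ℕ, (1 - Real.sqrt q⁻¹ * q⁻¹ ^ k)) =
      jacobiF (q⁻¹ ^ 3) (q⁻¹ ^ 8) / ∏' k : ℕ, (1 - q⁻¹ ^ 2 * (q⁻¹ ^ 2) ^ k) := by
  have hQ0 : 0 < q⁻¹ := by positivity
  have hQ1 : q⁻¹ < 1 := inv_lt_one_of_one_lt₀ hq
  generalize q⁻¹ = Q at *
  have hD := tprod_one_sub_mul_pow_pos (pow_pos hQ0 2) (pow_lt_one₀ hQ0.le hQ1 two_ne_zero)
  set t := Real.sqrt Q with htdef
  have ht : t ^ 2 = Q := Real.sq_sqrt hQ0.le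
  have htn : (-t) ^ 2 = Q := by rw [neg_sq, ht]
  have ht0 : t ≠ 0 := (Real.sqrt_pos.mpr hQ0).ne'
  have f1 := tprod_mul_tprod_eq_jacobiF (t := t) (by rwa [ht]) (by rwa [ht])
  have f2 := tprod_mul_tprod_eq_jacobiF (t := -t) (by rwa [htn]) (by rwa [htn])
  rw [ht] at f1
  rw [htn] at f2
  simp only [neg_mul, ← sub_eq_add_neg] at f2
  have hs := ((hasSum_jacobiF hQ0 hQ1 ht0).add
    (hasSum_jacobiF hQ0 hQ1 (neg_ne_zero.mpr ht0))).mul_left (1 / 2)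
  have hinj : Function.Injective fun m : ℤ ↦ 2 * m := fun a b h ↦ by simpa using h
  rw [← hinj.hasSum_iff] at hs
  · have h8 := hasSum_jacobiF (s := Q ^ 4) (X := Q ^ 3) (by positivity)
      (pow_lt_one₀ hQ0.le hQ1 four_ne_zero) (by positivity)
    rw [← pow_mul] at h8
    have key : jacobiF (Q ^ 3) (Q ^ 8) = 1 / 2 * (jacobiF t (Q ^ 2) + jacobiF (-t) (Q ^ 2)) := by
      refine (h8.congr_fun fun m ↦ ?_).unique hs
      simp only [Function.comp_apply]
      have a1 : t ^ (2 * m) = Q ^ m := by rw [zpow_mul, ← ht]; norm_cast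
      have a2 : (-t) ^ (2 * m) = Q ^ m := by rw [zpow_mul, ← htn]; norm_cast
      rw [a1, a2, ← zpow_natCast Q 4, ← zpow_natCast Q 3, ← zpow_mul, ← zpow_mul,
        ← zpow_add₀ hQ0.ne', ← zpow_add₀ hQ0.ne', ← two_mul, one_div,
        inv_mul_cancel_left₀ two_ne_zero]
      congr 1
      push_cast
      ring
    rw [eq_div_iff hD.ne', key, ← f1, ← f2]
    ring
  · intro k hk
    have hodd : Odd k := by
      rw [← Int.not_even_iff_odd]
      rintro ⟨m, rfl⟩
      exact hk ⟨m, by simp [two_mul]⟩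
    rw [hodd.neg_zpow]
    ring
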